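/- Let φ be a comparison function, (X, d) a metric space, n ∈ ℕ, and 𝕂 be ℝ or ℂ. A non-empty subset A of BLip_φ(X, 𝕂^n) is precompact (with respect to the norm ⦀f⦀_φ = ‖f‖_∞ + |f|_φ) if and only if A is bounded and satisfies both the condition (DS) and the condition (LDS). -/

import Mathlib

open Pointwise Metric

/-- A comparison function. -/
structure IsCompFun (φ : ℝ → ℝ) : Prop where
  nonneg : ∀ t : ℝ, 0 ≤ t → 0 ≤ φ t
  map_zero : φ 0 = 0
  right_cont : ContinuousWithinAt φ (Set.Ici 0) 0
  concave : ConcaveOn ℝ (Set.Ici 0) φ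
  ne_zero : ∃ t : ℝ, 0 ≤ t ∧ φ t ≠ 0

/-- The Lipschitz seminorm `|f|_φ`. -/
noncomputable def lipSemi {X E : Type*} [MetricSpace X] [NormedAddCommGroup E]
    (φ : ℝ → ℝ) (f : X → E) : ℝ :=
  sSup {r : ℝ | ∃ x y : X, x ≠ y ∧ r = ‖f x - f y‖ / φ (dist x y)}

/-- Membership in `Lip_φ(X,E)`. -/
def MemLip {X E : Type*} [MetricSpace X] [NormedAddCommGroup E]
    (φ : ℝ → ℝ) (f : X → E) : Prop :=
  BddAbove {r : ℝ | ∃ x y : X, x ≠ y ∧ r = ‖f x - f y‖ / φ (dist x y)}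

/-- The norm `⦀f⦀_φ = ‖f‖_∞ + |f|_φ` of `BLip_φ(X,E)`. -/
noncomputable def bLipNorm {X E : Type*} [MetricSpace X] [NormedAddCommGroup E]
    (φ : ℝ → ℝ) (f : X → E) : ℝ :=
  (⨆ x : X, ‖f x‖) + lipSemi φ f

/-- Precompactness of `A` with respect to the gauge `N`. -/
def Precomp {α : Type*} [Sub α] (N : α → ℝ) (A : Set α) : Prop :=
  ∀ ε : ℝ, 0 < ε → ∃ T : Set α, T ⊆ A ∧ T.Finite ∧ ∀ f ∈ A, ∃ g ∈ T, N (f - g) ≤ ε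

/-- Condition (LDS). -/
def CondLDS {X E : Type*} [MetricSpace X] [NormedAddCommGroup E] [NormedSpace ℝ E]
    (φ : ℝ → ℝ) (S : Set (X → E)) : Prop :=
  ∀ ε : ℝ, 0 < ε → ∃ (N : ℕ) (U : Fin N → Set (X × X)),
    (∀ i, U i ⊆ {p : X × X | p.1 ≠ p.2}) ∧
    {p : X × X | p.1 ≠ p.2} ⊆ ⋃ i, U i ∧
    ∀ i : Fin N, ∀ p ∈ U i, ∀ q ∈ U i, ∀ f ∈ S,
      ‖(φ (dist p.1 p.2))⁻¹ • (f p.1 - f p.2) -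
        (φ (dist q.1 q.2))⁻¹ • (f q.1 - f q.2)‖ ≤ ε

/-- Condition (DS) for a set of (bounded) maps `X → E`. -/
def CondDS {X E : Type*} [NormedAddCommGroup E] (S : Set (X → E)) : Prop :=
  ∀ ε : ℝ, 0 < ε → ∃ (N : ℕ) (U : Fin N → Set X),
    (∀ i, (U i).Nonempty) ∧ (⋃ i, U i) = Set.univ ∧
    ∀ i : Fin N, ∀ x ∈ U i, ∀ y ∈ U i, ∀ f ∈ S, ‖f x - f y‖ ≤ ε

/-- The values of `f` together with its `φ`-difference quotients. -/
noncomputable def valuesAndQuotients {X E : Type*} [MetricSpace X] [NormedAddCommGroup E]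
    [NormedSpace ℝ E] (φ : ℝ → ℝ) (f : X → E) : X ⊕ {p : X × X // p.1 ≠ p.2} → E :=
  Sum.elim f fun p => (φ (dist p.1.1 p.1.2))⁻¹ • (f p.1.1 - f p.1.2)

/-- A family of maps `I → E` admits, for every `ε > 0`, a finite colouring of `I` such that every
member of the family oscillates by at most `ε` on each colour class. -/
def HasSmallOscColorings {α I E : Type*} [NormedAddCommGroup E] (Φ : α → I → E) (A : Set α) :
    Prop :=
  ∀ ε : ℝ, 0 < ε → ∃ (κ : Type) (_ : Finite κ) (c : I → κ),
    ∀ i j, c i = c j → ∀ f ∈ A, ‖Φ f i - Φ f j‖ ≤ ε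

section Colorings

variable {α I E : Type*} [NormedAddCommGroup E] [ProperSpace E] {Φ : α → I → E} {A : Set α}

/-- A uniformly bounded family with small oscillation colourings is totally bounded in the
supremum norm. -/
theorem HasSmallOscColorings.exists_finite_net (h : HasSmallOscColorings Φ A) {M : ℝ}
    (hM : ∀ f ∈ A, ∀ i, ‖Φ f i‖ ≤ M) {ε : ℝ} (hε : 0 < ε) :
    ∃ T ⊆ A, T.Finite ∧ ∀ f ∈ A, ∃ g ∈ T, ∀ i, ‖Φ f i - Φ g i‖ ≤ ε := by
  obtain ⟨κ, _, c, hc⟩ := h (ε / 3) (by positivity)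
  have := Fintype.ofFinite (Set.range c)
  choose r hr using fun k : Set.range c => k.2
  let ev : α → Set.range c → E := fun f k => Φ f (r k)
  have hb : TotallyBounded (ev '' A) := by
    refine TotallyBounded.subset subset_closure (Bornology.IsBounded.isCompact_closure
      (isBounded_iff_forall_norm_le.2 ⟨max M 0, ?_⟩)).totallyBounded
    rintro _ ⟨f, hf, rfl⟩
    exact (pi_norm_le_iff_of_nonneg (le_max_right _ _)).2
      fun k => (hM f hf _).trans (le_max_left _ _)
  obtain ⟨t, ht, htf, hcov⟩ :=
    hb.exists_subset (Metric.dist_mem_uniformity (show 0 < ε / 3 by positivity))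
  obtain ⟨T, hTA, hTf, rfl⟩ := Set.exists_subset_image_finite_and.1 ⟨t, ht, htf, rfl⟩
  refine ⟨T, hTA, hTf, fun f hf => ?_⟩
  have hmem := hcov ⟨f, hf, rfl⟩
  simp only [Set.mem_iUnion] at hmem
  obtain ⟨_, ⟨g, hg, rfl⟩, hd⟩ := hmem
  refine ⟨g, hg, fun i => ?_⟩
  let k : Set.range c := ⟨c i, i, rfl⟩
  have h1 := hc i (r k) (hr k).symm f hf
  have h2 := hc (r k) i (hr k) g (hTA hg)
  have h3 : ‖Φ f (r k) - Φ g (r k)‖ ≤ ε / 3 := by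
    rw [← dist_eq_norm]
    exact (dist_le_pi_dist (ev f) (ev g) k).trans (le_of_lt hd)
  calc ‖Φ f i - Φ g i‖
      = ‖(Φ f i - Φ f (r k)) + (Φ f (r k) - Φ g (r k)) + (Φ g (r k) - Φ g i)‖ := by
        congr 1; abel
    _ ≤ ε / 3 + ε / 3 + ε / 3 := norm_add_le_of_le (norm_add_le_of_le h1 h3) h2
    _ = ε := by ring

/-- A family of bounded maps that is totally bounded in the supremum norm has small oscillation
colourings. -/
theorem hasSmallOscColorings_of_exists_finite_net (hA : ∀ f ∈ A, ∃ M, ∀ i, ‖Φ f i‖ ≤ M)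
    (h : ∀ ε : ℝ, 0 < ε →
      ∃ T ⊆ A, T.Finite ∧ ∀ f ∈ A, ∃ g ∈ T, ∀ i, ‖Φ f i - Φ g i‖ ≤ ε) :
    HasSmallOscColorings Φ A := by
  intro ε hε
  obtain ⟨T, hTA, hTf, hT⟩ := h (ε / 3) (by positivity)
  have := hTf.fintype
  choose! M hM using hA
  let ev : I → T → E := fun i g => Φ g i
  have hb : TotallyBounded (Set.range ev) := by
    refine TotallyBounded.subset subset_closure (Bornology.IsBounded.isCompact_closure
      (isBounded_iff_forall_norm_le.2 ⟨∑ g : T, |M g|, ?_⟩)).totallyBounded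
    rintro _ ⟨i, rfl⟩
    refine (pi_norm_le_iff_of_nonneg (Finset.sum_nonneg fun _ _ => abs_nonneg _)).2 fun g => ?_
    exact ((hM g (hTA g.2) i).trans (le_abs_self _)).trans
      (Finset.single_le_sum (f := fun g : T => |M g|) (fun _ _ => abs_nonneg _)
        (Finset.mem_univ g))
  obtain ⟨t, htf, hcov⟩ := Metric.totallyBounded_iff.1 hb (ε / 6) (by positivity)
  have hex : ∀ i, ∃ y : t, ev i ∈ Metric.ball (y : T → E) (ε / 6) := by
    intro i
    simpa using hcov ⟨i, rfl⟩
  choose c hc using hex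
  have := htf.to_subtype
  refine ⟨Fin (Nat.card t), inferInstance, fun i => Finite.equivFin t (c i),
    fun i j hij f hf => ?_⟩
  have hij' : c i = c j := (Finite.equivFin t).injective hij
  obtain ⟨g, hg, hfg⟩ := hT f hf
  have h1 := hfg i
  have h2 : ‖Φ g j - Φ f j‖ ≤ ε / 3 := by rw [norm_sub_rev]; exact hfg j
  have h3 : ‖Φ g i - Φ g j‖ ≤ ε / 3 := by
    rw [← dist_eq_norm]
    refine (dist_le_pi_dist (ev i) (ev j) ⟨g, hg⟩).trans ?_
    have hi := Metric.mem_ball.1 (hc i)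
    have hj := Metric.mem_ball'.1 (hc j)
    rw [← hij'] at hj
    linarith [dist_triangle (ev i) (c i : T → E) (ev j)]
  calc ‖Φ f i - Φ f j‖
      = ‖(Φ f i - Φ g i) + (Φ g i - Φ g j) + (Φ g j - Φ f j)‖ := by
        congr 1; abel
    _ ≤ ε / 3 + ε / 3 + ε / 3 := norm_add_le_of_le (norm_add_le_of_le h1 h3) h2
    _ = ε := by ring

end Colorings

section BLip

variable {X E : Type*} [MetricSpace X] [NormedAddCommGroup E] {φ : ℝ → ℝ} {f g : X → E}

theorem lipSemi_nonneg (hφ : IsCompFun φ) : 0 ≤ lipSemi φ f := by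
  refine Real.sSup_nonneg ?_
  rintro _ ⟨x, y, _, rfl⟩
  exact div_nonneg (norm_nonneg _) (hφ.nonneg _ dist_nonneg)

theorem MemLip.sub (hφ : IsCompFun φ) (hf : MemLip φ f) (hg : MemLip φ g) :
    MemLip φ (f - g) := by
  obtain ⟨a, ha⟩ := hf
  obtain ⟨b, hb⟩ := hg
  refine ⟨a + b, ?_⟩
  rintro _ ⟨x, y, hxy, rfl⟩
  refine le_trans ?_ (add_le_add (ha ⟨x, y, hxy, rfl⟩) (hb ⟨x, y, hxy, rfl⟩))
  rw [← add_div]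
  refine div_le_div_of_nonneg_right ?_ (hφ.nonneg _ dist_nonneg)
  rw [Pi.sub_apply, Pi.sub_apply, sub_sub_sub_comm]
  exact norm_sub_le _ _

variable [NormedSpace ℝ E]

theorem valuesAndQuotients_sub (i : X ⊕ {p : X × X // p.1 ≠ p.2}) :
    valuesAndQuotients φ (f - g) i = valuesAndQuotients φ f i - valuesAndQuotients φ g i := by
  rcases i with x | p
  · rfl
  · simp only [valuesAndQuotients, Sum.elim_inr, Pi.sub_apply, ← smul_sub]
    congr 1; abel

theorem norm_valuesAndQuotients_inr (hφ : IsCompFun φ) (p : {p : X × X // p.1 ≠ p.2}) :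
    ‖valuesAndQuotients φ f (Sum.inr p)‖ =
      ‖f p.1.1 - f p.1.2‖ / φ (dist p.1.1 p.1.2) := by
  simp only [valuesAndQuotients, Sum.elim_inr, norm_smul, norm_inv, Real.norm_eq_abs,
    abs_of_nonneg (hφ.nonneg _ dist_nonneg), div_eq_inv_mul]

theorem norm_valuesAndQuotients_le_bLipNorm (hφ : IsCompFun φ) (hf : MemLip φ f) {C : ℝ}
    (hC : ∀ x, ‖f x‖ ≤ C) (i : X ⊕ {p : X × X // p.1 ≠ p.2}) :
    ‖valuesAndQuotients φ f i‖ ≤ bLipNorm φ f := by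
  rcases i with x | p
  · exact (le_ciSup (f := fun x => ‖f x‖) ⟨C, by rintro _ ⟨y, rfl⟩; exact hC y⟩ x).trans
      (le_add_of_nonneg_right (lipSemi_nonneg hφ))
  · rw [norm_valuesAndQuotients_inr hφ]
    exact (le_csSup hf ⟨p.1.1, p.1.2, p.2, rfl⟩).trans
      (le_add_of_nonneg_left (Real.iSup_nonneg fun _ => norm_nonneg _))

theorem bLipNorm_le (hφ : IsCompFun φ) {a : ℝ} (ha : 0 ≤ a)
    (h : ∀ i, ‖valuesAndQuotients φ f i‖ ≤ a) : bLipNorm φ f ≤ a + a := by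
  refine add_le_add (Real.iSup_le (fun x => h (Sum.inl x)) ha) (Real.sSup_le ?_ ha)
  rintro _ ⟨x, y, hxy, rfl⟩
  simpa only [norm_valuesAndQuotients_inr hφ] using h (Sum.inr ⟨(x, y), hxy⟩)

theorem hasSmallOscColorings_iff {A : Set (X → E)} :
    HasSmallOscColorings (valuesAndQuotients φ) A ↔ CondDS A ∧ CondLDS φ A := by
  constructor
  · intro h
    refine ⟨fun ε hε => ?_, fun ε hε => ?_⟩ <;> obtain ⟨κ, _, c, hc⟩ := h ε hε
    · let c' : X → κ := fun x => c (Sum.inl x)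
      let e := Finite.equivFin (Set.range c')
      refine ⟨Nat.card (Set.range c'), fun k => {x | c' x = e.symm k}, fun k => (e.symm k).2,
        Set.eq_univ_of_forall fun x => Set.mem_iUnion.2 ⟨e ⟨c' x, x, rfl⟩, ?_⟩,
        fun k x hx y hy f hf => hc (Sum.inl x) (Sum.inl y) (Eq.trans hx (Eq.symm hy)) f hf⟩
      rw [Set.mem_ofPred_eq, e.symm_apply_apply]
    · let e := Finite.equivFin κ
      refine ⟨Nat.card κ, fun k => {p | ∃ hp : p.1 ≠ p.2, c (Sum.inr ⟨p, hp⟩) = e.symm k},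
        fun k p hp => hp.1, fun p hp => Set.mem_iUnion.2 ⟨e (c (Sum.inr ⟨p, hp⟩)), hp, ?_⟩, ?_⟩
      · simp
      · rintro k p ⟨hp, hpk⟩ q ⟨hq, hqk⟩ f hf
        exact hc (Sum.inr ⟨p, hp⟩) (Sum.inr ⟨q, hq⟩) (hpk.trans hqk.symm) f hf
  · rintro ⟨hDS, hLDS⟩ ε hε
    obtain ⟨N, U, -, hUcov, hU⟩ := hDS ε hε
    obtain ⟨N', V, -, hVcov, hV⟩ := hLDS ε hε
    choose c hc using fun x : X => Set.mem_iUnion.1 (hUcov.symm ▸ Set.mem_univ x : x ∈ ⋃ i, U i)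
    choose d hd using fun p : {p : X × X // p.1 ≠ p.2} => Set.mem_iUnion.1 (hVcov p.2)
    refine ⟨Fin N ⊕ Fin N', inferInstance, Sum.map c d, ?_⟩
    rintro (x | p) (y | q) hij f hf
    · exact hU (c x) x (hc x) y (Sum.inl_injective hij ▸ hc y) f hf
    · exact absurd hij Sum.inl_ne_inr
    · exact absurd hij Sum.inr_ne_inl
    · exact hV (d p) p (hd p) q (Sum.inr_injective hij ▸ hd q) f hf

/-- The compactness criterion for maps into a proper normed space. -/
theorem precomp_bLipNorm_iff [ProperSpace E] (hφ : IsCompFun φ) {A : Set (X → E)}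
    (hAL : ∀ f ∈ A, MemLip φ f ∧ ∃ C : ℝ, ∀ x : X, ‖f x‖ ≤ C) :
    Precomp (bLipNorm φ) A ↔
      (∃ M : ℝ, ∀ f ∈ A, bLipNorm φ f ≤ M) ∧ CondDS A ∧ CondLDS φ A := by
  have hle : ∀ f ∈ A, ∀ i, ‖valuesAndQuotients φ f i‖ ≤ bLipNorm φ f := fun f hf =>
    norm_valuesAndQuotients_le_bLipNorm hφ (hAL f hf).1 (hAL f hf).2.choose_spec
  have hsub : ∀ f ∈ A, ∀ g ∈ A, ∀ i,
      ‖valuesAndQuotients φ f i - valuesAndQuotients φ g i‖ ≤ bLipNorm φ (f - g) := by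
    intro f hf g hg i
    obtain ⟨hfL, C, hC⟩ := hAL f hf
    obtain ⟨hgL, D, hD⟩ := hAL g hg
    rw [← valuesAndQuotients_sub]
    exact norm_valuesAndQuotients_le_bLipNorm hφ (hfL.sub hφ hgL)
      (fun x => norm_sub_le_of_le (hC x) (hD x)) i
  rw [← hasSmallOscColorings_iff]
  constructor
  · intro h
    refine ⟨?_, hasSmallOscColorings_of_exists_finite_net (fun f hf => ⟨_, hle f hf⟩) ?_⟩
    · obtain ⟨T, hTA, hTf, hT⟩ := h 1 one_pos
      obtain ⟨K, hK⟩ := (hTf.image (bLipNorm φ)).bddAbove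
      refine ⟨(1 + |K|) + (1 + |K|), fun f hf => bLipNorm_le hφ (by positivity) fun i => ?_⟩
      obtain ⟨g, hg, hfg⟩ := hT f hf
      have h1 := (hsub f hf g (hTA hg) i).trans hfg
      have h2 := ((hle g (hTA hg) i).trans (hK ⟨g, hg, rfl⟩)).trans (le_abs_self K)
      linarith [norm_le_norm_sub_add (valuesAndQuotients φ f i) (valuesAndQuotients φ g i)]
    · intro ε hε
      obtain ⟨T, hTA, hTf, hT⟩ := h ε hε
      refine ⟨T, hTA, hTf, fun f hf => ?_⟩
      obtain ⟨g, hg, hfg⟩ := hT f hf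
      exact ⟨g, hg, fun i => (hsub f hf g (hTA hg) i).trans hfg⟩
  · rintro ⟨⟨M, hM⟩, h⟩ ε hε
    obtain ⟨T, hTA, hTf, hT⟩ :=
      h.exists_finite_net (fun f hf i => (hle f hf i).trans (hM f hf)) (half_pos hε)
    refine ⟨T, hTA, hTf, fun f hf => ?_⟩
    obtain ⟨g, hg, hfg⟩ := hT f hf
    refine ⟨g, hg, ?_⟩
    rw [← add_halves ε]
    exact bLipNorm_le hφ (half_pos hε).le fun i => by
      rw [valuesAndQuotients_sub]; exact hfg i

end BLip

/-- **Compactness criterion in `BLip_φ(X,𝕂ⁿ)`** for `𝕂 = ℝ` or `ℂ`. -/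
theorem stmt_14 (n : ℕ) (𝕂 : Type*) [RCLike 𝕂] {X : Type*} [MetricSpace X]
    (φ : ℝ → ℝ) (hφ : IsCompFun φ)
    (A : Set (X → EuclideanSpace 𝕂 (Fin n))) (hA : A.Nonempty)
    (hAL : ∀ f ∈ A, MemLip φ f ∧ ∃ C : ℝ, ∀ x : X, ‖f x‖ ≤ C) :
    Precomp (bLipNorm φ) A ↔
      (∃ M : ℝ, ∀ f ∈ A, bLipNorm φ f ≤ M) ∧ CondDS A ∧ CondLDS φ A := by
  exact precomp_bLipNorm_iff hφ hAL
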